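/- Let L be a relational first-order language and let 𝕏 be a countably infinite ultrahomogeneous L-structure with universe X whose age has the strong amalgamation property. Then there exists a family {A_α : α < 2^ℵ₀} of large copies of 𝕏, of cardinality continuum, which is almost disjoint: A_α ∩ A_β is finite for all α ≠ β. -/

import Mathlib

open FirstOrder FirstOrder.Language Set CategoryTheory

universe u w

/-- For a relational language, any subset of a structure carries an induced substructure. -/
def inducedSub (L : Language.{u}) [L.IsRelational] {M : Type w} [L.Structure M]
    (A : Set M) : L.Substructure M where
  carrier := A
  fun_mem := fun {_} f => isEmptyElim f

/-- `A` is a copy of `M`: the induced substructure on `A` is isomorphic to `M`. -/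
def IsCopy (L : Language.{u}) [L.IsRelational] {M : Type w} [L.Structure M]
    (A : Set M) : Prop :=
  Nonempty ((inducedSub L A) ≃[L] M)

/-- The orbit of `x` under automorphisms of `M` fixing `F` pointwise. -/
def orb (L : Language.{u}) {M : Type w} [L.Structure M] (F : Set M) (x : M) : Set M :=
  {y | ∃ g : M ≃[L] M, (∀ a ∈ F, g a = a) ∧ g x = y}

/-- A copy is large if it meets every orbit in an infinite set. -/
def IsLargeCopy (L : Language.{u}) [L.IsRelational] {M : Type w} [L.Structure M]
    (A : Set M) : Prop :=
  IsCopy L A ∧ ∀ F : Set M, F.Finite → ∀ x ∈ (Set.univ : Set M) \ F,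
    (A ∩ orb L F x).Infinite

/-- The age of `M` (as a class of bundled structures): finite structures embeddable in `M`. -/
def InAge (L : Language.{u}) (M : Type w) [L.Structure M]
    (N : Bundled.{w} L.Structure) : Prop :=
  Finite N ∧ Nonempty (N ↪[L] M)

/-- The age of `M` has the strong amalgamation property. -/
def AgeHasSAP (L : Language.{u}) (M : Type w) [L.Structure M] : Prop :=
  ∀ A B C : Bundled.{w} L.Structure, InAge L M A → InAge L M B → InAge L M C →
    ∀ (f₀ : A ↪[L] B) (g₀ : A ↪[L] C),
      ∃ D : Bundled.{w} L.Structure, InAge L M D ∧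
        ∃ (f₁ : B ↪[L] D) (g₁ : C ↪[L] D),
          f₁.comp f₀ = g₁.comp g₀ ∧
          Set.range f₁ ∩ Set.range g₁ = Set.range (f₁.comp f₀)


theorem inducedSub_finite (L : Language.{u}) [L.IsRelational] {M : Type w} [L.Structure M]
    {A : Set M} (h : A.Finite) : Finite (inducedSub L A) := h.to_subtype

/-- Under SAP and ultrahomogeneity all orbits are infinite. -/
theorem orb_infinite (L : Language.{u}) [L.IsRelational]
    (M : Type w) [L.Structure M]
    (hM : L.IsUltrahomogeneous M) (hSAP : AgeHasSAP L M)
    (F : Set M) (hF : F.Finite) (x : M) (hx : x ∉ F) : (orb L F x).Infinite := by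
  intro hO
  have fA := inducedSub_finite L hF
  have fB := inducedSub_finite L (hF.union hO)
  have fC := inducedSub_finite L (hF.insert x)
  have hAB : inducedSub L F ≤ inducedSub L (F ∪ orb L F x) := fun a ha => Or.inl ha
  have hAC : inducedSub L F ≤ inducedSub L (insert x F) := fun a ha => Or.inr ha
  obtain ⟨D, ⟨_, ⟨h⟩⟩, f₁, g₁, hcomp, hran⟩ := hSAP ⟨inducedSub L F, inferInstance⟩
    ⟨inducedSub L (F ∪ orb L F x), inferInstance⟩ ⟨inducedSub L (insert x F), inferInstance⟩
    ⟨fA, ⟨Substructure.subtype _⟩⟩ ⟨fB, ⟨Substructure.subtype _⟩⟩ ⟨fC, ⟨Substructure.subtype _⟩⟩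
    (Substructure.inclusion hAB) (Substructure.inclusion hAC)
  obtain ⟨g, hg⟩ := hM _ (Substructure.FG.of_finite (h := fB)) (h.comp f₁)
  obtain ⟨k, hk⟩ := hM _ (Substructure.FG.of_finite (h := fC)) (h.comp g₁)
  have hg' : ∀ y, h (f₁ y) = g y.1 := fun y => DFunLike.congr_fun hg y
  have hk' : ∀ y, h (g₁ y) = k y.1 := fun y => DFunLike.congr_fun hk y
  have hc : ∀ a : inducedSub L F, f₁ (Substructure.inclusion hAB a) =
      g₁ (Substructure.inclusion hAC a) := fun a => DFunLike.congr_fun hcomp a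
  have hy : g.symm (k x) ∈ orb L F x := by
    refine ⟨g.symm.comp k, fun a ha => ?_, rfl⟩
    change g.symm (k a) = a
    have h1 := hg' (Substructure.inclusion hAB ⟨a, ha⟩)
    have h2 := hk' (Substructure.inclusion hAC ⟨a, ha⟩)
    rw [hc] at h1
    have h3 : g a = k a := h1.symm.trans h2
    rw [← h3, Language.Equiv.symm_apply_apply]
  let xC : inducedSub L (insert x F) := ⟨x, Or.inl rfl⟩
  let yB : inducedSub L (F ∪ orb L F x) := ⟨g.symm (k x), Or.inr hy⟩
  have e : f₁ yB = g₁ xC := by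
    apply h.injective
    rw [hg', hk']
    exact Language.Equiv.apply_symm_apply g (k x)
  have : g₁ xC ∈ Set.range f₁ ∩ Set.range g₁ := ⟨⟨yB, e⟩, ⟨xC, rfl⟩⟩
  rw [hran] at this
  obtain ⟨a, ha⟩ := this
  have ha' : g₁ (Substructure.inclusion hAC a) = g₁ xC := (hc a).symm.trans ha
  have := congrArg Subtype.val (g₁.injective ha')
  apply hx
  change a.1 = x at this
  rw [← this]; exact a.2

theorem isCopy_of_meets (L : Language.{u}) [L.IsRelational]
    (M : Type w) [L.Structure M] [Countable M] (hM : L.IsUltrahomogeneous M) (A : Set M)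
    (hA : ∀ F : Set M, F.Finite → ∀ x, x ∉ F → (A ∩ orb L F x).Nonempty) : IsCopy L A := by
  have h1 : L.IsExtensionPair (inducedSub L A) M := by
    rw [isExtensionPair_iff_exists_embedding_closure_singleton_sup]
    intro S hS f m
    exact hM.extend_embedding (h := ⟨(Substructure.subtype _).comp (Substructure.subtype _)⟩)
      (S.fg_iff_structure_fg.1 hS) f _
  have h2 : L.IsExtensionPair M (inducedSub L A) := by
    rw [isExtensionPair_iff_exists_embedding_closure_singleton_sup]
    intro S hS f m
    obtain ⟨g, hg⟩ := hM S hS ((Substructure.subtype _).comp f)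
    have hg' : ∀ s : S, (f s).1 = g s.1 := fun y => DFunLike.congr_fun hg y
    have key : ∃ k : M ≃[L] M, (∀ s : S, (f s).1 = k s.1) ∧ k m ∈ A := by
      by_cases hm : m ∈ S
      · exact ⟨g, hg', hg' ⟨m, hm⟩ ▸ (f ⟨m, hm⟩).2⟩
      · have := hS.finite
        obtain ⟨a, haA, q, hq, hqa⟩ := hA (Set.range fun s : S => (f s).1) (Set.finite_range _)
          (g m) (by
            rintro ⟨s, hs⟩
            have h3 : g s.1 = g m := (hg' s).symm.trans hs
            exact hm (g.injective h3 ▸ s.2))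
        refine ⟨q.comp g, fun s => ?_, ?_⟩
        · change _ = q (g s.1)
          rw [← hg', hq _ ⟨s, rfl⟩]
        · change q (g m) ∈ A
          rw [hqa]; exact haA
    obtain ⟨k, hk, hkm⟩ := key
    have hle : Substructure.closure L {m} ⊔ S ≤ (inducedSub L A).comap k.toHom := by
      refine sup_le ?_ ?_
      · rw [Substructure.closure_le]
        rintro _ rfl
        exact hkm
      · intro s hs
        change k s ∈ A
        rw [← hk ⟨s, hs⟩]
        exact (f _).2
    refine ⟨Embedding.codRestrict _ (k.toEmbedding.comp (Substructure.subtype _))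
      fun c => hle c.2, ?_⟩
    ext s
    exact hk s
  have : Countable (inducedSub L A) := (Set.to_countable A).to_subtype
  obtain ⟨e, _⟩ := equiv_between_cg (L := L) (M := inducedSub L A) (N := M)
    Structure.cg_of_countable Structure.cg_of_countable
    ⟨⟨⊥, _, ((Substructure.subtype _).comp (Substructure.subtype _)).equivRange⟩,
      Substructure.fg_bot⟩ h1 h2
  exact ⟨e⟩

theorem exists_inj_choice_nat {M : Type w} (S : ℕ → Set M) (hS : ∀ i, (S i).Infinite) :
    ∃ p : ℕ → M, Function.Injective p ∧ ∀ i, p i ∈ S i := by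
  classical
  have hch : ∀ n (l : Finset M), ∃ a ∈ S n, a ∉ l := fun n l => (hS n).exists_notMem_finset l
  choose c hc hc' using hch
  let q : ℕ → Finset M := fun n => Nat.rec ∅ (fun n l => insert (c n l) l) n
  have hq : ∀ n, q (n + 1) = insert (c n (q n)) (q n) := fun n => rfl
  have hmono : Monotone q := monotone_nat_of_le_succ fun n => by
    rw [hq]; exact Finset.subset_insert _ _
  have hlt : ∀ i j, i < j → c i (q i) ≠ c j (q j) := fun i j hij h => by
    apply hc' j (q j)
    rw [← h]
    exact hmono (Nat.succ_le_of_lt hij) (by rw [Nat.succ_eq_add_one, hq]; simp)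
  refine ⟨fun n => c n (q n), fun i j h => ?_, fun i => hc _ _⟩
  rcases lt_trichotomy i j with h' | h' | h'
  · exact (hlt _ _ h' h).elim
  · exact h'
  · exact (hlt _ _ h' h.symm).elim

theorem exists_inj_choice {ι : Type} [Countable ι] {M : Type w} (S : ι → Set M)
    (hS : ∀ i, (S i).Infinite) :
    ∃ p : ι → M, Function.Injective p ∧ ∀ i, p i ∈ S i := by
  rcases isEmpty_or_nonempty ι with h | h
  · exact ⟨isEmptyElim, fun i => isEmptyElim i, isEmptyElim⟩
  obtain ⟨f, hf⟩ := exists_injective_nat ι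
  obtain ⟨p, hp, hpS⟩ := exists_inj_choice_nat (fun n => S (Function.invFun f n)) fun _ => hS _
  refine ⟨fun i => p (f i), hp.comp hf, fun i => ?_⟩
  have := hpS (f i)
  rwa [Function.leftInverse_invFun hf i] at this

theorem exists_ad_family {M : Type w} (T : ℕ → Set M) (hT : ∀ i, (T i).Infinite) :
    ∃ A : (ℕ → Bool) → Set M, (∀ f n, (A f ∩ T n).Infinite) ∧
      ∀ f g, f ≠ g → (A f ∩ A g).Finite := by
  obtain ⟨p, hp, hpS⟩ := exists_inj_choice (ι := Σ n : ℕ, (Fin n → Bool))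
    (fun s => T (Nat.unpair s.1).1) fun _ => hT _
  refine ⟨fun f => Set.range fun m : ℕ => p ⟨m, fun i => f i⟩, fun f n => ?_, fun f g hfg => ?_⟩
  · have : (Set.range fun k : ℕ => p ⟨Nat.pair n k, fun i => f i⟩).Infinite := by
      apply Set.infinite_range_of_injective
      intro k l h
      have := congrArg Sigma.fst (hp h)
      simpa using this
    refine this.mono ?_
    rintro _ ⟨k, rfl⟩
    refine ⟨⟨_, rfl⟩, ?_⟩
    have := hpS ⟨Nat.pair n k, fun i => f i⟩
    simpa using this
  · obtain ⟨d, hd⟩ := Function.ne_iff.1 hfg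
    refine ((Set.finite_Iic d).image fun m : ℕ => p ⟨m, fun i => f i⟩).subset ?_
    rintro _ ⟨⟨m, rfl⟩, ⟨m', h⟩⟩
    refine ⟨m, ?_, rfl⟩
    have h := hp h
    by_contra hm
    simp only [Set.mem_Iic, not_le] at hm
    have h1 : m' = m := congrArg Sigma.fst h
    subst h1
    have h2 := eq_of_heq (Sigma.mk.inj h).2
    exact hd (congrFun h2 ⟨d, hm⟩).symm

theorem ad_family_of_large_copies (L : Language.{u}) [L.IsRelational]
    (M : Type w) [L.Structure M] [Countable M] [Infinite M]
    (hM : L.IsUltrahomogeneous M) (hSAP : AgeHasSAP L M) :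
    ∃ 𝒜 : Set (Set M), Cardinal.mk 𝒜 = Cardinal.continuum ∧
      (∀ A ∈ 𝒜, IsLargeCopy L A) ∧
      (∀ A ∈ 𝒜, ∀ B ∈ 𝒜, A ≠ B → (A ∩ B).Finite) := by
  have hinf := orb_infinite L M hM hSAP
  let I := {p : Finset M × M // p.2 ∉ p.1}
  obtain ⟨x₀⟩ : Nonempty M := inferInstance
  have : Nonempty I := ⟨⟨(∅, x₀), by simp⟩⟩
  obtain ⟨e, he⟩ := exists_surjective_nat I
  obtain ⟨A, hA, hAd⟩ := exists_ad_family (fun n => orb L (↑(e n).1.1 : Set M) (e n).1.2)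
    fun n => hinf _ (Finset.finite_toSet _) _ (by simpa using (e n).2)
  have hmeet : ∀ f, ∀ F : Set M, F.Finite → ∀ x, x ∉ F → (A f ∩ orb L F x).Infinite := by
    intro f F hF x hx
    obtain ⟨n, hn⟩ := he ⟨(hF.toFinset, x), by simpa using hx⟩
    have := hA f n
    simpa [hn] using this
  have hinj : Function.Injective A := by
    intro f g hfg
    by_contra hne
    have h1 := hAd f g hne
    rw [← hfg, Set.inter_self] at h1
    exact (hA f 0) (h1.subset Set.inter_subset_left)
  refine ⟨Set.range A, ?_, ?_, ?_⟩
  · have := Cardinal.mk_range_eq_of_injective hinj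
    simpa using this
  · rintro _ ⟨f, rfl⟩
    exact ⟨isCopy_of_meets L M hM _ fun F hF x hx => (hmeet f F hF x hx).nonempty,
      fun F hF x hx => hmeet f F hF x hx.2⟩
  · rintro _ ⟨f, rfl⟩ _ ⟨g, rfl⟩ hne
    exact hAd f g fun h => hne (h ▸ rfl)
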